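/- Let 0 < h ≤ 1 and let F = (a, h·x) be a signal forming an (h, η, γ)-regular cluster: the nodes of F are h x_1 < … < h x_d where (a, x) is an (η, γ)-regular signal, i.e. x_1 < … < x_d lie in [−1, 1] with x_{j+1} − x_j ≥ η (0 < η ≤ 2/(d−1)) and γ ≤ |a_j| ≤ 1 for all j (0 < γ ≤ 1). Then for every signal F̃ with at most l nodes, l < d, ‖m̄(F) − m̄(F̃)‖ ≥ min( h^{2d−2}, (η^{d(d−1)} γ^d h^{2d−2} ∏_{i=1}^{d−1} (i!)^2) / (√(2d−1) · d^2 · d! · (d+1)^{d−1}) ), where m̄(G) = (m_0(G),…,m_{2d−2}(G)) ∈ ℝ^{2d−1} and ‖·‖ is the Euclidean norm. -/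

import Mathlib

lemma aux_prod {ι : Type*} (s : Finset ι) (f g : ι → ℝ) (M ε : ℝ) (hM : 0 ≤ M)
    (hf : ∀ i, |f i| ≤ M) (hg : ∀ i, |g i| ≤ M) (hfg : ∀ i, |f i - g i| ≤ ε) :
    M * |∏ i ∈ s, f i - ∏ i ∈ s, g i| ≤ s.card * M ^ s.card * ε := by
  classical
  induction s using Finset.induction_on with
  | empty => simp
  | insert i s hi ih =>
    rw [Finset.prod_insert hi, Finset.prod_insert hi, Finset.card_insert_of_notMem hi]
    have hp : |∏ i ∈ s, f i| ≤ M ^ s.card := by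
      rw [Finset.abs_prod]
      calc ∏ i ∈ s, |f i| ≤ ∏ i ∈ s, M := Finset.prod_le_prod (fun _ _ => abs_nonneg _) (fun i _ => hf i)
        _ = M ^ s.card := by simp
    have e : f i * ∏ i ∈ s, f i - g i * ∏ i ∈ s, g i
      = (f i - g i) * ∏ i ∈ s, f i + g i * (∏ i ∈ s, f i - ∏ i ∈ s, g i) := by ring
    rw [e]
    have h1 : |(f i - g i) * ∏ i ∈ s, f i| ≤ ε * M ^ s.card := by
      rw [abs_mul]
      exact mul_le_mul (hfg i) hp (abs_nonneg _) ((abs_nonneg _).trans (hfg i))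
    have h2 : |g i * (∏ i ∈ s, f i - ∏ i ∈ s, g i)| ≤ M * |∏ i ∈ s, f i - ∏ i ∈ s, g i| := by
      rw [abs_mul]
      exact mul_le_mul_of_nonneg_right (hg i) (abs_nonneg _)
    calc _ ≤ M * (ε * M ^ s.card + s.card * M ^ s.card * ε) := by
          refine mul_le_mul_of_nonneg_left ((abs_add_le _ _).trans ?_) hM
          linarith
      _ = _ := by push_cast; ring

lemma aux_det (d : ℕ) (A B : Matrix (Fin d) (Fin d) ℝ) (M ε : ℝ) (hM : 0 ≤ M)
    (hf : ∀ i j, |A i j| ≤ M) (hg : ∀ i j, |B i j| ≤ M) (hfg : ∀ i j, |A i j - B i j| ≤ ε) :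
    M * |A.det - B.det| ≤ d.factorial * (d * M ^ d * ε) := by
  rw [Matrix.det_apply, Matrix.det_apply, ← Finset.sum_sub_distrib]
  calc _ ≤ M * ∑ σ : Equiv.Perm (Fin d), |∏ i, A (σ i) i - ∏ i, B (σ i) i| := by
        refine mul_le_mul_of_nonneg_left ((Finset.abs_sum_le_sum_abs _ _).trans ?_) hM
        refine Finset.sum_le_sum fun σ _ => ?_
        rw [← smul_sub]
        rcases Int.units_eq_one_or (Equiv.Perm.sign σ) with h | h <;> rw [h] <;> simp [abs_sub_comm]
    _ ≤ ∑ σ : Equiv.Perm (Fin d), (d * M ^ d * ε) := by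
        rw [Finset.mul_sum]
        refine Finset.sum_le_sum fun σ _ => ?_
        simpa using aux_prod Finset.univ (fun i => A (σ i) i) (fun i => B (σ i) i) M ε hM
          (fun i => hf _ _) (fun i => hg _ _) (fun i => hfg _ _)
    _ = _ := by simp [Fintype.card_perm]

lemma aux_hankel_eq (d r : ℕ) (b y : Fin r → ℝ) :
    (Matrix.of fun i j : Fin d => ∑ k, b k * y k ^ ((i : ℕ) + (j : ℕ)))
      = (Matrix.of fun (i : Fin d) (k : Fin r) => b k * y k ^ (i : ℕ)) *
        (Matrix.of fun (k : Fin r) (j : Fin d) => y k ^ (j : ℕ)) := by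
  ext i j
  simp only [Matrix.mul_apply, Matrix.of_apply]
  exact Finset.sum_congr rfl fun k _ => by rw [pow_add]; ring

lemma aux_hankel_zero (d r : ℕ) (hr : r < d) (b y : Fin r → ℝ) :
    (Matrix.of fun i j : Fin d => ∑ k, b k * y k ^ ((i : ℕ) + (j : ℕ))).det = 0 := by
  by_contra hne
  have hu := (Matrix.isUnit_iff_isUnit_det _).2 (isUnit_iff_ne_zero.2 hne)
  have h1 := Matrix.rank_of_isUnit _ hu
  rw [aux_hankel_eq] at h1
  have h2 := (Matrix.rank_mul_le_left (Matrix.of fun (i : Fin d) (k : Fin r) => b k * y k ^ (i : ℕ))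
        (Matrix.of fun (k : Fin r) (j : Fin d) => y k ^ (j : ℕ))).trans (Matrix.rank_le_width _)
  rw [h1] at h2
  simp at h2
  omega

lemma aux_hankel_det (d : ℕ) (a x : Fin d → ℝ) :
    (Matrix.of fun i j : Fin d => ∑ k, a k * x k ^ ((i : ℕ) + (j : ℕ))).det
      = (∏ i, a i) * (Matrix.vandermonde x).det ^ 2 := by
  have : (Matrix.of fun (i : Fin d) (k : Fin d) => a k * x k ^ (i : ℕ))
      = (Matrix.vandermonde x).transpose * Matrix.diagonal a := by
    ext i k
    simp [Matrix.mul_diagonal, Matrix.vandermonde_apply, mul_comm]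
  rw [aux_hankel_eq, Matrix.det_mul, this, Matrix.det_mul, Matrix.det_transpose, Matrix.det_diagonal]
  have : (Matrix.of fun (k : Fin d) (j : Fin d) => x k ^ (j : ℕ)) = Matrix.vandermonde x := by
    ext; simp [Matrix.vandermonde_apply]
  rw [this]; ring

lemma aux_sep (d : ℕ) (x : Fin d → ℝ) (η : ℝ)
    (hsep : ∀ (j : ℕ) (hj : j + 1 < d), x ⟨j + 1, hj⟩ - x ⟨j, Nat.lt_of_succ_lt hj⟩ ≥ η)
    (i : ℕ) (n : ℕ) (hn : i + n < d) : η * n ≤ x ⟨i + n, hn⟩ - x ⟨i, by omega⟩ := by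
  induction n with
  | zero => simp
  | succ n ih =>
    have h1 := ih (by omega)
    have h2 := hsep (i + n) (by omega)
    have e : (⟨i + n + 1, by omega⟩ : Fin d) = ⟨i + (n + 1), hn⟩ := rfl
    rw [e] at h2
    push_cast
    linarith

lemma aux_vand (n : ℕ) (x : Fin (n + 1) → ℝ) (η : ℝ) (hη : 0 < η)
    (hsep : ∀ (j : ℕ) (hj : j + 1 < n + 1), x ⟨j + 1, hj⟩ - x ⟨j, Nat.lt_of_succ_lt hj⟩ ≥ η) :
    η ^ ((n + 1) * n) * ∏ i ∈ Finset.Icc 1 n, (Nat.factorial i : ℝ) ^ 2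
      ≤ (Matrix.vandermonde x).det ^ 2 := by
  have hsf : ∏ i ∈ Finset.Icc 1 n, (Nat.factorial i : ℝ) ^ 2
      = (∏ i : Fin (n + 1), ∏ j ∈ Finset.Ioi i, ((j : ℕ) - (i : ℕ) : ℝ)) ^ 2 := by
    have h1 := Matrix.det_vandermonde_id_eq_superFactorial (R := ℝ) n
    rw [Matrix.det_vandermonde, ← Nat.prod_Icc_factorial] at h1
    rw [h1, Finset.prod_pow]
    push_cast
    rfl
  have hpow : η ^ ((n + 1) * n) = (∏ i : Fin (n + 1), ∏ j ∈ Finset.Ioi i, η) ^ 2 := by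
    simp only [Finset.prod_const, Fin.card_Ioi]
    rw [Finset.prod_pow_eq_pow_sum, ← pow_mul]
    congr 1
    rw [Fin.sum_univ_eq_sum_range (fun i => n + 1 - 1 - i) (n + 1)]
    rw [Finset.sum_range_reflect (fun i => i) (n + 1), Finset.sum_range_id_mul_two]
    simp
  rw [hsf, hpow, ← mul_pow, Matrix.det_vandermonde, ← Finset.prod_mul_distrib]
  simp only [← Finset.prod_mul_distrib]
  have key : ∀ i : Fin (n + 1), ∀ j ∈ Finset.Ioi i, 0 ≤ η * ((j : ℕ) - (i : ℕ) : ℝ) ∧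
      η * ((j : ℕ) - (i : ℕ) : ℝ) ≤ x j - x i := by
    intro i j hj
    have hij : (i : ℕ) < j := by simpa using hj
    obtain ⟨m, hm⟩ := Nat.exists_eq_add_of_lt hij
    have h1 := aux_sep (n + 1) x η hsep i (m + 1) (by omega)
    have e : (⟨(i : ℕ) + (m + 1), by omega⟩ : Fin (n + 1)) = j := Fin.ext (by simp; omega)
    rw [e] at h1
    have e2 : ((j : ℕ) : ℝ) - (i : ℕ) = ((m + 1 : ℕ) : ℝ) := by rw [hm]; push_cast; ring
    rw [e2]
    exact ⟨by positivity, h1⟩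
  refine pow_le_pow_left₀ ?_ ?_ 2
  · exact Finset.prod_nonneg fun i _ => Finset.prod_nonneg fun j hj => (key i j hj).1
  · exact Finset.prod_le_prod (fun i _ => Finset.prod_nonneg fun j hj => (key i j hj).1)
      fun i _ => Finset.prod_le_prod (fun j hj => (key i j hj).1) fun j hj => (key i j hj).2

lemma aux_main (n : ℕ) (a x : Fin (n + 1) → ℝ)
    (hrange : ∀ j, x j ∈ Set.Icc (-1 : ℝ) 1)
    (η : ℝ) (hη : 0 < η)
    (hsep : ∀ (j : ℕ) (hj : j + 1 < n + 1), x ⟨j + 1, hj⟩ - x ⟨j, Nat.lt_of_succ_lt hj⟩ ≥ η)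
    (γ : ℝ) (hγ : 0 < γ)
    (hamp : ∀ j, γ ≤ |a j|) (hamp1 : ∀ j, |a j| ≤ 1)
    (r : ℕ) (hr : r < n + 1) (b y : Fin r → ℝ) (ε : ℝ) (hε : ε ≤ 1)
    (H : ∀ k < 2 * n + 1, |(∑ i, a i * x i ^ k) - ∑ j, b j * y j ^ k| ≤ ε) :
    η ^ ((n + 1) * n) * γ ^ (n + 1) * ∏ i ∈ Finset.Icc 1 n, (Nat.factorial i : ℝ) ^ 2 ≤
      (n + 1).factorial * ((n + 1 : ℕ) * ((n + 1 : ℕ) + 1) ^ n * ε) := by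
  have hm : ∀ k, |∑ i, a i * x i ^ k| ≤ (n + 1 : ℕ) := by
    intro k
    calc _ ≤ ∑ i, |a i * x i ^ k| := Finset.abs_sum_le_sum_abs _ _
      _ ≤ ∑ i : Fin (n + 1), (1 : ℝ) := Finset.sum_le_sum fun i _ => by
          rw [abs_mul, abs_pow]
          exact mul_le_one₀ (hamp1 i) (by positivity)
            (pow_le_one₀ (abs_nonneg _) (abs_le.2 (hrange i)))
      _ = _ := by simp
  have hd := aux_det (n + 1) (Matrix.of fun i j : Fin (n + 1) => ∑ k, a k * x k ^ ((i : ℕ) + (j : ℕ)))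
    (Matrix.of fun i j : Fin (n + 1) => ∑ k, b k * y k ^ ((i : ℕ) + (j : ℕ)))
    ((n + 1 : ℕ) + 1) ε (by positivity)
    (fun i j => by
      have := hm (i + j)
      simp only [Matrix.of_apply]; linarith)
    (fun i j => by
      have h1 := hm (i + j)
      have h2 := H (i + j) (by omega)
      simp only [Matrix.of_apply]
      rw [abs_le] at *
      constructor <;> linarith)
    (fun i j => by
      have h2 := H (i + j) (by omega)
      simpa only [Matrix.of_apply] using h2)
  rw [aux_hankel_zero _ _ hr, sub_zero, aux_hankel_det, abs_mul,
    abs_of_nonneg (sq_nonneg (Matrix.vandermonde x).det),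
    Finset.abs_prod] at hd
  have hv := aux_vand n x η hη hsep
  have hg : γ ^ (n + 1) ≤ ∏ i, |a i| := by
    calc γ ^ (n + 1) = ∏ i : Fin (n + 1), γ := by simp
      _ ≤ _ := Finset.prod_le_prod (fun _ _ => hγ.le) fun i _ => hamp i
  have hgv := mul_le_mul hg hv (by positivity) ((by positivity : (0:ℝ) ≤ γ ^ (n + 1)).trans hg)
  have hM : (0 : ℝ) < (n + 1 : ℕ) + 1 := by positivity
  refine le_of_mul_le_mul_left ?_ hM
  calc _ ≤ (((n + 1 : ℕ) : ℝ) + 1) * ((∏ i, |a i|) * (Matrix.vandermonde x).det ^ 2) := by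
        refine mul_le_mul_of_nonneg_left ?_ hM.le
        linarith
    _ ≤ _ := hd
    _ = _ := by rw [pow_succ]; ring

theorem moment_difference_lower_bound_cluster
    (d : ℕ) (hd : 1 ≤ d) (a x : Fin d → ℝ)
    (h : ℝ) (hh : 0 < h) (hh1 : h ≤ 1)
    (ha : ∀ i, a i ≠ 0) (hmono : StrictMono x)
    (hrange : ∀ j, x j ∈ Set.Icc (-1 : ℝ) 1)
    (η : ℝ) (hη : 0 < η) (hη' : η ≤ 2 / ((d : ℝ) - 1))
    (hsep : ∀ (j : ℕ) (hj : j + 1 < d), x ⟨j + 1, hj⟩ - x ⟨j, Nat.lt_of_succ_lt hj⟩ ≥ η)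
    (γ : ℝ) (hγ : 0 < γ) (hγ1 : γ ≤ 1)
    (hamp : ∀ j, γ ≤ |a j|) (hamp1 : ∀ j, |a j| ≤ 1)
    (l : ℕ) (hl : l < d)
    (r : ℕ) (hr : r ≤ l) (b y : Fin r → ℝ)
    (hb : ∀ i, b i ≠ 0) (hy : Function.Injective y) :
    Real.sqrt (∑ k ∈ Finset.range (2 * d - 1),
        ((∑ i, a i * (h * x i) ^ k) - (∑ j, b j * y j ^ k)) ^ 2) ≥
      min (h ^ (2 * d - 2))
        ((η ^ (d * (d - 1)) * γ ^ d * h ^ (2 * d - 2)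
            * ∏ i ∈ Finset.Icc 1 (d - 1), (Nat.factorial i : ℝ) ^ 2) /
          (Real.sqrt (2 * d - 1) * (d : ℝ) ^ 2 * (Nat.factorial d : ℝ)
            * ((d : ℝ) + 1) ^ (d - 1))) := by
  obtain ⟨n, rfl⟩ : ∃ n, d = n + 1 := ⟨d - 1, by omega⟩
  have e1 : 2 * (n + 1) - 1 = 2 * n + 1 := by omega
  have e2 : 2 * (n + 1) - 2 = 2 * n := by omega
  have e3 : n + 1 - 1 = n := by omega
  rw [e1, e2, e3, ge_iff_le]
  set S := Real.sqrt (∑ k ∈ Finset.range (2 * n + 1),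
        ((∑ i, a i * (h * x i) ^ k) - (∑ j, b j * y j ^ k)) ^ 2) with hS
  have hS0 : 0 ≤ S := Real.sqrt_nonneg _
  have hp : 0 < h ^ (2 * n) := by positivity
  by_cases hc : h ^ (2 * n) ≤ S
  · exact (min_le_left _ _).trans hc
  push Not at hc
  refine (min_le_right _ _).trans ?_
  have hk : ∀ k < 2 * n + 1, |(∑ i, a i * (h * x i) ^ k) - ∑ j, b j * y j ^ k| ≤ S := by
    intro k hk
    rw [← Real.sqrt_sq_eq_abs]
    refine Real.sqrt_le_sqrt ?_
    exact Finset.single_le_sum (f := fun k => ((∑ i, a i * (h * x i) ^ k) - (∑ j, b j * y j ^ k)) ^ 2)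
      (fun _ _ => sq_nonneg _) (Finset.mem_range.2 hk)
  have main := aux_main n a x hrange η hη hsep γ hγ hamp hamp1 r (by omega) b (fun j => y j / h)
    (S / h ^ (2 * n)) ((div_le_one hp).2 hc.le) (by
      intro k hk'
      have h1 := hk k hk'
      have e : (∑ i, a i * (h * x i) ^ k) - ∑ j, b j * y j ^ k
          = h ^ k * ((∑ i, a i * x i ^ k) - ∑ j, b j * (y j / h) ^ k) := by
        rw [mul_sub, Finset.mul_sum, Finset.mul_sum]
        congr 1
        · exact Finset.sum_congr rfl fun i _ => by rw [mul_pow]; ring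
        · refine Finset.sum_congr rfl fun i _ => ?_
          rw [div_pow]; field_simp
      rw [e, abs_mul, abs_of_pos (pow_pos hh k)] at h1
      rw [le_div_iff₀ hp]
      have h2 : h ^ (2 * n) ≤ h ^ k := pow_le_pow_of_le_one hh.le hh1 (by omega)
      have h3 := mul_le_mul_of_nonneg_right h2 (abs_nonneg ((∑ i, a i * x i ^ k) - ∑ j, b j * (y j / h) ^ k))
      linarith)
  have hsq : (1 : ℝ) ≤ Real.sqrt (2 * (n + 1 : ℕ) - 1) := by
    rw [Real.one_le_sqrt]; push_cast
    have : (0 : ℝ) ≤ n := by positivity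
    linarith
  have hd1 : (1 : ℝ) ≤ (n + 1 : ℕ) := by exact_mod_cast hd
  have hsq0 : 0 < Real.sqrt (2 * (n + 1 : ℕ) - 1) := by linarith
  rw [div_le_iff₀ (by positivity)]
  have main2 := mul_le_mul_of_nonneg_right main hp.le
  have e4 : ((n + 1).factorial : ℝ) * ((n + 1 : ℕ) * ((n + 1 : ℕ) + 1) ^ n * (S / h ^ (2 * n))) * h ^ (2 * n)
     = S * ((n + 1 : ℕ) * (n + 1).factorial * ((n + 1 : ℕ) + 1) ^ n) := by
    field_simp
  rw [e4] at main2
  have hge : (1 : ℝ) ≤ Real.sqrt (2 * (n + 1 : ℕ) - 1) * (n + 1 : ℕ) := one_le_mul_of_one_le_of_one_le hsq hd1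
  have h5 := mul_le_mul_of_nonneg_right hge
    (by positivity : 0 ≤ S * (((n + 1 : ℕ) : ℝ) * (n + 1).factorial * ((n + 1 : ℕ) + 1) ^ n))
  calc _ = _ := by ring
    _ ≤ _ := main2
    _ = _ := (one_mul _).symm
    _ ≤ _ := h5
    _ = _ := by ring
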